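/- Let (Ω, μ) be a finite measure space and let 1 ≤ p < q ≤ ∞. For a measurable function u : Ω → ℝ with ‖u‖_{L^q(μ)} < ∞, the max operator F(u) := max(0, u) is Newton differentiable at u from L^q(μ) to L^p(μ) with generalized derivative given by multiplication with the indicator of the set {x : u(x) > 0}. Precisely: for every such u and every ε > 0 there exists δ > 0 such that for every measurable h : Ω → ℝ with 0 < ‖h‖_{L^q(μ)} < δ, one has ‖ max(0, u + h) − max(0, u) − 1_{{x : u(x) + h(x) > 0}} · h ‖_{L^p(μ)} ≤ ε ‖h‖_{L^q(μ)}. -/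

import Mathlib

open MeasureTheory ENNReal

lemma norm_max_zero_newton_remainder_le_indicator {Ω : Type*} (u h : Ω → ℝ) (x : Ω) :
    ‖max 0 (u x + h x) - max 0 (u x) - Set.indicator {x | 0 < u x + h x} h x‖ ≤
      ‖Set.indicator {x | 0 < |u x| ∧ |u x| ≤ |h x|} h x‖ := by
  simp only [Set.indicator_apply, Set.mem_ofPred_eq, Real.norm_eq_abs]
  rcases lt_trichotomy (u x) 0 with hu | hu | hu <;>
  rcases le_or_gt (u x + h x) 0 with huh | huh
  · simp [max_eq_left huh, max_eq_left hu.le, huh.not_gt]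
  · have hle : |u x| ≤ |h x| := by
      rw [abs_of_neg hu, abs_of_pos (by linarith)]
      linarith
    simp [max_eq_right huh.le, max_eq_left hu.le, huh, hu.ne, hle]
  · simp_all [not_lt_of_ge]
  · simp_all [le_of_lt]
  · have hle : |u x| ≤ |h x| := by
      rw [abs_of_pos hu, abs_of_neg (by linarith)]
      linarith
    simp [max_eq_left huh, max_eq_right hu.le, huh.not_gt, hu.ne', hle]
  · simp [max_eq_right huh.le, max_eq_right hu.le, huh]

lemma exists_measure_abs_pos_le_lt {Ω : Type*} [MeasurableSpace Ω] (μ : Measure Ω)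
    [IsFiniteMeasure μ] {u : Ω → ℝ} (hu : Measurable u) {η : ℝ≥0∞} (hη : 0 < η) :
    ∃ t : ℝ, 0 < t ∧ μ {x | 0 < |u x| ∧ |u x| ≤ t} < η := by
  have hlim := tendsto_measure_biInter_gt (μ := μ) (a := (0 : ℝ))
    (s := fun t => {x | 0 < |u x| ∧ |u x| ≤ t})
    (fun t _ => ((measurableSet_lt measurable_const hu.abs).inter
      (measurableSet_le hu.abs measurable_const)).nullMeasurableSet)
    (fun _ _ _ hij _ hx => ⟨hx.1, hx.2.trans hij⟩)
    ⟨1, one_pos, measure_ne_top _ _⟩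
  have hempty : ⋂ t > (0 : ℝ), {x | 0 < |u x| ∧ |u x| ≤ t} = ∅ := by
    refine Set.eq_empty_iff_forall_notMem.2 fun x hx => ?_
    simp only [Set.mem_iInter, Set.mem_ofPred_eq] at hx
    have hpos := (hx 1 one_pos).1
    linarith [(hx (|u x| / 2) (half_pos hpos)).2]
  rw [hempty, measure_empty] at hlim
  exact ((eventually_mem_nhdsWithin).and (hlim.eventually_lt_const hη)).exists

lemma exists_measure_abs_pos_le_abs_le {Ω : Type*} [MeasurableSpace Ω] (μ : Measure Ω)
    [IsFiniteMeasure μ] {q : ℝ≥0∞} (hq : 1 ≤ q) {u : Ω → ℝ} (hu : Measurable u)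
    {η : ℝ≥0∞} (hη : 0 < η) :
    ∃ δ : ℝ, 0 < δ ∧ ∀ h : Ω → ℝ, Measurable h → eLpNorm h q μ < ENNReal.ofReal δ →
      μ {x | 0 < |u x| ∧ |u x| ≤ |h x|} ≤ η := by
  obtain ⟨t, ht, htμ⟩ := exists_measure_abs_pos_le_lt μ hu (ENNReal.half_pos hη.ne')
  set C : ℝ≥0∞ := μ Set.univ ^ (1 / (1 : ℝ≥0∞).toReal - 1 / q.toReal)
  have hC : C ≠ ⊤ := by
    refine ENNReal.rpow_ne_top_of_nonneg ?_ (measure_ne_top _ _)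
    rcases eq_or_ne q ⊤ with rfl | hq_top
    · simp
    · have := ENNReal.toReal_mono hq_top hq
      simp only [toReal_one] at this ⊢
      rw [sub_nonneg]
      simpa using inv_le_one_of_one_le₀ this
  have htη : ENNReal.ofReal t * (η / 2) ≠ 0 :=
    mul_ne_zero (by simpa using ht) (ENNReal.half_pos hη.ne').ne'
  obtain ⟨d, hd, hdC⟩ := ENNReal.exists_nnreal_pos_mul_lt hC htη
  refine ⟨d, hd, fun h hh hlt => ?_⟩
  rw [ENNReal.ofReal_coe_nnreal] at hlt
  have hmarkov : μ {x | t ≤ |h x|} ≤ η / 2 := by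
    have h_one : ENNReal.ofReal t * μ {x | t ≤ |h x|} ≤ eLpNorm h 1 μ := by
      rw [eLpNorm_one_eq_lintegral_enorm]
      convert mul_meas_ge_le_lintegral₀ (μ := μ) hh.enorm.aemeasurable (ENNReal.ofReal t) using 4
      simp only [Real.enorm_eq_ofReal_abs, ENNReal.ofReal_le_ofReal_iff (abs_nonneg _)]
    have h_le := h_one.trans <|
      (eLpNorm_le_eLpNorm_mul_rpow_measure_univ hq hh.aestronglyMeasurable).trans <|
      (mul_le_mul_left hlt.le C).trans hdC.le
    exact (ENNReal.mul_le_mul_iff_right (by simpa using ht) ENNReal.ofReal_ne_top).1 h_le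
  calc μ {x | 0 < |u x| ∧ |u x| ≤ |h x|}
      ≤ μ ({x | 0 < |u x| ∧ |u x| ≤ t} ∪ {x | t ≤ |h x|}) := by
        refine measure_mono fun x hx => ?_
        rcases le_total (|u x|) t with hut | hut
        · exact Or.inl ⟨hx.1, hut⟩
        · exact Or.inr (hut.trans hx.2)
    _ ≤ η / 2 + η / 2 := (measure_union_le _ _).trans (add_le_add htμ.le hmarkov)
    _ = η := ENNReal.add_halves η

/-- Newton differentiability of the max operator `u ↦ max(0, u)` from `L^q` to
`L^p` on a finite measure space, `1 ≤ p < q ≤ ∞`, with generalized derivative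
given by multiplication with the indicator of `{u > 0}`. -/
theorem max_newton_differentiable
    {Ω : Type*} [MeasurableSpace Ω] (μ : Measure Ω) [IsFiniteMeasure μ]
    (p q : ℝ≥0∞) (hp : 1 ≤ p) (hpq : p < q)
    (u : Ω → ℝ) (hu : Measurable u) (huq : eLpNorm u q μ < ⊤) :
    ∀ ε : ℝ, 0 < ε → ∃ δ : ℝ, 0 < δ ∧
      ∀ h : Ω → ℝ, Measurable h →
        0 < eLpNorm h q μ → eLpNorm h q μ < ENNReal.ofReal δ →
        eLpNorm (fun x => max 0 (u x + h x) - max 0 (u x)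
            - Set.indicator {x | 0 < u x + h x} h x) p μ
          ≤ ENNReal.ofReal ε * eLpNorm h q μ := by
  intro ε hε
  have hp_pos : 0 < p.toReal := ENNReal.toReal_pos (one_pos.trans_le hp).ne' hpq.ne_top
  have hs : 0 < 1 / p.toReal - 1 / q.toReal := by
    rcases eq_or_ne q ⊤ with rfl | hq_top
    · simpa using hp_pos
    · exact sub_pos.2 (one_div_lt_one_div_of_lt hp_pos (ENNReal.toReal_strict_mono hq_top hpq))
  set s := 1 / p.toReal - 1 / q.toReal with hs_def
  obtain ⟨δ, hδ, H⟩ := exists_measure_abs_pos_le_abs_le μ (hp.trans hpq.le) hu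
    (η := ENNReal.ofReal ε ^ s⁻¹)
    (ENNReal.rpow_pos (ENNReal.ofReal_pos.2 hε) ENNReal.ofReal_ne_top)
  refine ⟨δ, hδ, fun h hh _ hlt => ?_⟩
  set A := {x | 0 < |u x| ∧ |u x| ≤ |h x|}
  have hA : MeasurableSet A :=
    (measurableSet_lt measurable_const hu.abs).inter (measurableSet_le hu.abs hh.abs)
  calc _ ≤ eLpNorm (A.indicator h) p μ :=
        eLpNorm_mono (norm_max_zero_newton_remainder_le_indicator u h)
    _ = eLpNorm h p (μ.restrict A) := eLpNorm_indicator_eq_eLpNorm_restrict hA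
    _ ≤ eLpNorm h q (μ.restrict A) * μ A ^ s := by
        simpa [hs_def] using eLpNorm_le_eLpNorm_mul_rpow_measure_univ (μ := μ.restrict A) hpq.le
          hh.aestronglyMeasurable
    _ ≤ eLpNorm h q μ * (ENNReal.ofReal ε ^ s⁻¹) ^ s := by
        gcongr
        · exact Measure.restrict_le_self
        · exact H h hh hlt
    _ = ENNReal.ofReal ε * eLpNorm h q μ := by
        rw [ENNReal.rpow_inv_rpow hs.ne', mul_comm]
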